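/- There exist a positive integer C_f and a constant L₀ > 0, both depending only on f, with the following property: for every y ∈ ℝ, all integers h, d with gcd(h, d) = 1, C_f < h ≤ L^{r−1} and |y − d/h| < 1/h², and every integer L ≥ L₀, one has |Σ_{n=1}^{L} e(f(n)·y)| ≤ L^{1−2^{−r−1}} + L·h^{−2^{−r−1}}, where e(t) := e^{2πit}. -/

import Mathlib

namespace WeylAux

/-- the additive character -/
noncomputable def ee (x : ℝ) : ℂ := Complex.exp (2 * Real.pi * Complex.I * (x : ℂ))

lemma ee_add (x y : ℝ) : ee (x + y) = ee x * ee y := by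
  unfold ee; rw [← Complex.exp_add]; congr 1; push_cast; ring

lemma norm_ee (x : ℝ) : ‖ee x‖ = 1 := by
  unfold ee
  have : (2 * Real.pi * Complex.I * (x : ℂ)) = ((2 * Real.pi * x : ℝ) : ℂ) * Complex.I := by
    push_cast; ring
  rw [this, Complex.norm_exp_ofReal_mul_I]

lemma ee_int (n : ℤ) : ee (n : ℝ) = 1 := by
  unfold ee
  rw [Complex.exp_eq_one_iff]
  exact ⟨n, by push_cast; ring⟩

lemma ee_zero : ee 0 = 1 := by simpa using ee_int 0

lemma ee_add_int (x : ℝ) (n : ℤ) : ee (x + n) = ee x := by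
  rw [ee_add, ee_int, mul_one]

lemma ee_neg (x : ℝ) : ee (-x) = (starRingEnd ℂ) (ee x) := by
  unfold ee
  rw [← Complex.exp_conj]; congr 1
  simp [Complex.conj_ofReal, Complex.conj_ofNat]

lemma ee_sub (x y : ℝ) : ee (x - y) = ee x * (starRingEnd ℂ) (ee y) := by
  rw [← ee_neg, ← ee_add, sub_eq_add_neg]

lemma ee_eq_I (x : ℝ) : ee x = Complex.exp (Complex.I * ((2 * Real.pi * x : ℝ) : ℂ)) := by
  unfold ee; congr 1; push_cast; ring

lemma norm_ee_sub_one_le (x : ℝ) : ‖ee x - 1‖ ≤ 2 * Real.pi * |x| := by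
  rw [ee_eq_I]
  refine Real.norm_exp_I_mul_ofReal_sub_one_le.trans ?_
  rw [Real.norm_eq_abs, abs_mul, abs_of_pos (by positivity)]

lemma norm_ee_sub_ee_le (x y : ℝ) : ‖ee x - ee y‖ ≤ 2 * Real.pi * |x - y| := by
  have : ee x - ee y = ee y * (ee (x - y) - 1) := by
    rw [mul_sub, ← ee_add]; simp
  rw [this, norm_mul, norm_ee, one_mul]
  exact norm_ee_sub_one_le _

/-- distance to nearest integer -/
noncomputable def nd (x : ℝ) : ℝ := |x - round x|

lemma nd_nonneg (x : ℝ) : 0 ≤ nd x := abs_nonneg _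
lemma nd_le (x : ℝ) (z : ℤ) : nd x ≤ |x - z| := round_le x z
lemma nd_neg (x : ℝ) : nd (-x) = nd x := by
  apply le_antisymm
  · refine (nd_le (-x) (-round x)).trans (le_of_eq ?_)
    unfold nd; rw [← abs_neg]; congr 1; push_cast; ring
  · refine (nd_le x (-round (-x))).trans (le_of_eq ?_)
    unfold nd; rw [← abs_neg]; congr 1; push_cast; ring

lemma four_nd_le (x : ℝ) : 4 * nd x ≤ ‖ee x - 1‖ := by
  have h1 : ee x = ee (x - round x) := by
    have := ee_add_int (x - round x) (round x)
    rw [← this]; congr 1; ring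
  rw [h1, ee_eq_I, Complex.norm_exp_I_mul_ofReal_sub_one, norm_mul, Real.norm_eq_abs,
    Real.norm_eq_abs]
  set t := x - round x with ht
  have h2 : |t| ≤ 1 / 2 := abs_sub_round x
  have hpi := Real.pi_pos
  have h3 : |2 * Real.pi * t / 2| = Real.pi * |t| := by
    rw [show 2 * Real.pi * t / 2 = Real.pi * t by ring, abs_mul, abs_of_pos hpi]
  have h4 := Real.mul_abs_le_abs_sin (x := 2 * Real.pi * t / 2) (by rw [h3]; nlinarith)
  rw [h3] at h4
  have h5 : 2 / Real.pi * (Real.pi * |t|) = 2 * |t| := by field_simp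
  rw [h5] at h4
  unfold nd
  rw [abs_of_pos (by norm_num : (0:ℝ) < 2)]
  linarith

/-- threshold majorant for linear sums -/
noncomputable def GG (L : ℕ) (δ : ℝ) (θ : ℝ) : ℝ := if nd θ < δ then (L : ℝ) else 1 / δ

lemma GG_nonneg (L : ℕ) {δ : ℝ} (hδ : 0 < δ) (θ : ℝ) : 0 ≤ GG L δ θ := by
  unfold GG; split_ifs <;> positivity

lemma GG_neg (L : ℕ) (δ θ : ℝ) : GG L δ (-θ) = GG L δ θ := by
  unfold GG; rw [nd_neg]

lemma GG_zero (L : ℕ) {δ : ℝ} (hδ : 0 < δ) : GG L δ 0 = L := by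
  unfold GG nd; simp [hδ]

lemma trivial_sum (φ : ℤ → ℝ) (a b : ℤ) (L : ℕ) (h : b - a ≤ L) :
    ‖∑ n ∈ Finset.Ico a b, ee (φ n)‖ ≤ L := by
  refine (norm_sum_le _ _).trans ?_
  simp only [norm_ee, Finset.sum_const, Int.card_Ico, nsmul_eq_mul, mul_one]
  exact_mod_cast (by omega : (b - a).toNat ≤ L)

lemma linear_tele (c θ : ℝ) (a : ℤ) (k : ℕ) :
    (∑ n ∈ Finset.Ico a (a + k), ee (c + n * θ)) * (ee θ - 1) =
      ee (c + (a + k) * θ) - ee (c + a * θ) := by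
  induction k with
  | zero => simp
  | succ k ih =>
    have : Finset.Ico a (a + ((k + 1 : ℕ) : ℤ)) = insert (a + (k : ℤ)) (Finset.Ico a (a + k)) := by
      ext x; simp only [Finset.mem_Ico, Finset.mem_insert]; push_cast; omega
    rw [this, Finset.sum_insert (by simp), add_mul, ih, mul_sub, ← ee_add]
    push_cast
    rw [show c + ((a:ℝ) + k) * θ + θ = c + (a + (k + 1)) * θ by ring]
    ring

lemma linear_sum (c θ : ℝ) (a b : ℤ) (L : ℕ) (h : b - a ≤ L) {δ : ℝ} (hδ : 0 < δ) :
    ‖∑ n ∈ Finset.Ico a b, ee (c + n * θ)‖ ≤ GG L δ θ := by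
  unfold GG
  split_ifs with hd
  · exact trivial_sum (fun n => c + n * θ) a b L h
  · push Not at hd
    rcases le_or_gt b a with hab | hab
    · rw [Finset.Ico_eq_empty (by omega)]; simp; positivity
    · obtain ⟨k, rfl⟩ : ∃ k : ℕ, b = a + k := ⟨(b - a).toNat, by omega⟩
      have h1 := congrArg norm (linear_tele c θ a k)
      rw [norm_mul] at h1
      have h2 : ‖ee (c + (a + k) * θ) - ee (c + a * θ)‖ ≤ 2 := by
        refine (norm_sub_le _ _).trans ?_
        rw [norm_ee, norm_ee]; norm_num
      have h3 := four_nd_le θ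
      rw [le_div_iff₀ hδ]
      have h4 := norm_nonneg (∑ n ∈ Finset.Ico a (a + (k:ℤ)), ee (c + n * θ))
      nlinarith

lemma sum_reindex (a b : ℤ) (L : ℕ) (h : b - a ≤ L) (F : ℤ → ℤ → ℂ) :
    ∑ n ∈ Finset.Ico a b, ∑ m ∈ Finset.Ico a b, F n m =
      ∑ k ∈ Finset.Ioo (-(L : ℤ)) L, ∑ n ∈ Finset.Ico (max a (a - k)) (min b (b - k)),
        F n (n + k) := by
  rw [Finset.sum_sigma', Finset.sum_sigma']
  refine Finset.sum_bij' (fun x _ => (⟨x.2 - x.1, x.1⟩ : (_ : ℤ) × ℤ))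
    (fun x _ => (⟨x.2, x.2 + x.1⟩ : (_ : ℤ) × ℤ)) ?_ ?_ ?_ ?_ ?_
  · rintro ⟨n, m⟩ hx
    simp only [Finset.mem_sigma, Finset.mem_Ico, Finset.mem_Ioo] at hx ⊢
    omega
  · rintro ⟨k, n⟩ hx
    simp only [Finset.mem_sigma, Finset.mem_Ico, Finset.mem_Ioo] at hx ⊢
    omega
  · rintro ⟨n, m⟩ hx; simp
  · rintro ⟨k, n⟩ hx; simp
  · rintro ⟨n, m⟩ hx; simp

lemma differencing (φ : ℤ → ℝ) (a b : ℤ) (L : ℕ) (h : b - a ≤ L) :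
    ‖∑ n ∈ Finset.Ico a b, ee (φ n)‖ ^ 2 ≤
      ∑ k ∈ Finset.Ioo (-(L : ℤ)) L, ‖∑ n ∈ Finset.Ico (max a (a - k)) (min b (b - k)),
        ee (φ (n + k) - φ n)‖ := by
  refine le_trans (le_of_eq ?_) (norm_sum_le _ _)
  rw [← sum_reindex a b L h (fun n m => ee (φ m - φ n))]
  have : ∑ n ∈ Finset.Ico a b, ∑ m ∈ Finset.Ico a b, ee (φ m - φ n) =
      (∑ n ∈ Finset.Ico a b, ee (φ n)) * (starRingEnd ℂ) (∑ n ∈ Finset.Ico a b, ee (φ n)) := by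
    rw [map_sum, Finset.sum_mul_sum, Finset.sum_comm]
    simp only [ee_sub]
  rw [this, norm_mul, RCLike.norm_conj, sq]

/-- polynomial phases -/
def PP : ℕ → (ℤ → ℝ) → ℝ → Prop
  | 0, φ, θ => ∀ n : ℤ, φ n = φ 0 + n * θ
  | j + 1, φ, θ => ∀ k : ℤ, PP j (fun n => φ (n + k) - φ n) (k * θ)

/-- iterated majorant -/
noncomputable def AA (G : ℝ → ℝ) (L : ℕ) : ℕ → ℝ → ℝ
  | 0, θ => G θ
  | j + 1, θ => ∑ k ∈ Finset.Ioo (-(L : ℤ)) L, AA G L j (k * θ)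

lemma weyl_diff {δ : ℝ} (hδ : 0 < δ) (L : ℕ) (hL : 1 ≤ L) (j : ℕ) :
    ∀ (φ : ℤ → ℝ) (θ : ℝ) (a b : ℤ), b - a ≤ L → PP j φ θ →
      ‖∑ n ∈ Finset.Ico a b, ee (φ n)‖ ^ (2 ^ j) * (2 * L : ℝ) ^ (j + 1) ≤
        (2 * L : ℝ) ^ (2 ^ j) * AA (GG L δ) L j θ := by
  induction j with
  | zero =>
    intro φ θ a b hab hP
    have h1 := linear_sum (φ 0) θ a b L hab hδ
    have h2 : ∑ n ∈ Finset.Ico a b, ee (φ n) = ∑ n ∈ Finset.Ico a b, ee (φ 0 + n * θ) :=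
      Finset.sum_congr rfl (fun n _ => by rw [hP n])
    rw [h2]
    simp only [pow_zero, pow_one, zero_add, AA]
    rw [mul_comm]
    gcongr
  | succ j ih =>
    intro φ θ a b hab hP
    set x := ‖∑ n ∈ Finset.Ico a b, ee (φ n)‖ with hx
    set K := Finset.Ioo (-(L : ℤ)) L with hK
    set Y : ℤ → ℝ := fun k => ‖∑ n ∈ Finset.Ico (max a (a - k)) (min b (b - k)),
        ee (φ (n + k) - φ n)‖ with hY
    have h1 : x ^ 2 ≤ ∑ k ∈ K, Y k := differencing φ a b L hab
    have h2 : ∀ k ∈ K, Y k ^ (2 ^ j) * (2 * L : ℝ) ^ (j + 1) ≤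
        (2 * L : ℝ) ^ (2 ^ j) * AA (GG L δ) L j (k * θ) := by
      intro k _
      exact ih (fun n => φ (n + k) - φ n) (k * θ) _ _ (by omega) (hP k)
    have hLpos : (0:ℝ) < 2 * L := by positivity
    have hY0 : ∀ k ∈ K, 0 ≤ Y k := fun k _ => norm_nonneg _
    obtain ⟨m, hm⟩ : ∃ m, 2 ^ j = m + 1 := ⟨2 ^ j - 1, by have := Nat.one_le_two_pow (n := j); omega⟩
    have h3 : (∑ k ∈ K, Y k) ^ (2 ^ j) ≤ (2 * L : ℝ) ^ m * ∑ k ∈ K, Y k ^ (2 ^ j) := by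
      have h := pow_sum_div_card_le_sum_pow hY0 m
      rw [← hm] at h
      have hc : (K.card : ℝ) ≤ 2 * L := by
        rw [hK, Int.card_Ioo]; exact_mod_cast (by omega : ((L:ℤ) - -(L:ℤ) - 1).toNat ≤ 2 * L)
      have hc0 : (0:ℝ) < K.card := by
        rw [hK, Int.card_Ioo]; exact_mod_cast (by omega : 0 < ((L:ℤ) - -(L:ℤ) - 1).toNat)
      rw [div_le_iff₀ (by positivity), mul_comm] at h
      refine h.trans ?_
      have : 0 ≤ ∑ k ∈ K, Y k ^ (2 ^ j) := Finset.sum_nonneg (fun k hk => pow_nonneg (hY0 k hk) _)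
      exact mul_le_mul_of_nonneg_right (pow_le_pow_left₀ hc0.le hc m) this
    calc x ^ (2 ^ (j + 1)) * (2 * L : ℝ) ^ (j + 1 + 1)
        = (x ^ 2) ^ (2 ^ j) * (2 * L : ℝ) ^ (j + 1 + 1) := by rw [← pow_mul, pow_succ' 2 j]
      _ ≤ (∑ k ∈ K, Y k) ^ (2 ^ j) * (2 * L : ℝ) ^ (j + 1 + 1) :=
          mul_le_mul_of_nonneg_right (pow_le_pow_left₀ (sq_nonneg x) h1 _) (by positivity)
      _ ≤ ((2 * L : ℝ) ^ m * ∑ k ∈ K, Y k ^ (2 ^ j)) * (2 * L : ℝ) ^ (j + 1 + 1) :=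
          mul_le_mul_of_nonneg_right h3 (by positivity)
      _ = (2 * L : ℝ) ^ (2 ^ j) * ∑ k ∈ K, (Y k ^ (2 ^ j) * (2 * L : ℝ) ^ (j + 1)) := by
          rw [hm, ← Finset.sum_mul]; ring
      _ ≤ (2 * L : ℝ) ^ (2 ^ j) * ∑ k ∈ K, ((2 * L : ℝ) ^ (2 ^ j) * AA (GG L δ) L j (k * θ)) := by
          exact mul_le_mul_of_nonneg_left (Finset.sum_le_sum h2) (by positivity)
      _ = (2 * L : ℝ) ^ (2 ^ (j + 1)) * AA (GG L δ) L (j + 1) θ := by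
          rw [← Finset.mul_sum, AA, pow_succ 2 j, pow_mul]; ring

lemma AA_nonneg {G : ℝ → ℝ} (hG : ∀ x, 0 ≤ G x) (L j : ℕ) : ∀ θ, 0 ≤ AA G L j θ := by
  induction j with
  | zero => intro θ; exact hG θ
  | succ j ih => intro θ; exact Finset.sum_nonneg (fun k _ => ih _)

lemma AA_neg {G : ℝ → ℝ} (hG : ∀ x, G (-x) = G x) (L j : ℕ) :
    ∀ θ, AA G L j (-θ) = AA G L j θ := by
  induction j with
  | zero => intro θ; exact hG θ
  | succ j ih =>
    intro θ
    refine Finset.sum_congr rfl (fun k _ => ?_)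
    rw [mul_neg, ih]

lemma AA_at_zero {G : ℝ → ℝ} (L : ℕ) (hG : ∀ x, 0 ≤ G x) (hG0 : G 0 = L) (j : ℕ) :
    AA G L j 0 ≤ (2 * L : ℝ) ^ j * L := by
  induction j with
  | zero => simp [AA, hG0]
  | succ j ih =>
    simp only [AA, mul_zero, Finset.sum_const, nsmul_eq_mul]
    have hc : ((Finset.Ioo (-(L:ℤ)) L).card : ℝ) ≤ 2 * L := by
      rw [Int.card_Ioo]; exact_mod_cast (by omega : ((L:ℤ) - -(L:ℤ) - 1).toNat ≤ 2 * L)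
    calc _ ≤ (2 * L : ℝ) * ((2 * L : ℝ) ^ j * L) :=
          mul_le_mul hc ih (AA_nonneg hG L j 0) (by positivity)
      _ = _ := by ring

lemma even_sum_le (F : ℤ → ℝ) (hF : ∀ k, F (-k) = F k) (h0 : ∀ k, 0 ≤ F k) (L : ℕ) :
    ∑ k ∈ Finset.Ioo (-(L:ℤ)) L, F k ≤ F 0 + 2 * ∑ k ∈ Finset.Icc 1 L, F (k : ℤ) := by
  have key : ∀ L : ℕ, ∑ k ∈ Finset.Ioo (-((L:ℤ)+1)) (L+1), F k =
      F 0 + 2 * ∑ k ∈ Finset.Icc 1 L, F (k : ℤ) := by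
    intro L
    induction L with
    | zero =>
      have : Finset.Ioo (-(((0:ℕ):ℤ)+1)) ((0:ℕ)+1) = {0} := by
        ext x; simp only [Finset.mem_Ioo, Finset.mem_singleton]; push_cast; omega
      rw [this]; simp
    | succ L ih =>
      have : Finset.Ioo (-(((L+1:ℕ):ℤ)+1)) ((L+1:ℕ)+1) =
          insert ((L:ℤ)+1) (insert (-((L:ℤ)+1)) (Finset.Ioo (-((L:ℤ)+1)) (L+1))) := by
        ext x; simp only [Finset.mem_Ioo, Finset.mem_insert]; push_cast; omega
      rw [this, Finset.sum_insert, Finset.sum_insert, ih, hF,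
        Finset.sum_Icc_succ_top (by omega)]
      · push_cast; ring
      · simp
      · simp only [Finset.mem_Ioo, Finset.mem_insert]; omega
  rw [← key L]
  refine Finset.sum_le_sum_of_subset_of_nonneg ?_ (fun _ _ _ => h0 _)
  intro x; simp only [Finset.mem_Ioo]; omega

/-- iterated positive majorant -/
noncomputable def BB (G : ℝ → ℝ) (L : ℕ) : ℕ → ℝ → ℝ
  | 0, θ => G θ
  | j + 1, θ => ∑ k ∈ Finset.Icc 1 L, BB G L j (k * θ)

lemma AA_le_BB {G : ℝ → ℝ} (L : ℕ) (hG : ∀ x, 0 ≤ G x) (hG0 : G 0 = L)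
    (hGn : ∀ x, G (-x) = G x) (j : ℕ) : ∀ θ,
    AA G L j θ * (2 * L) ≤ j * (2 * L : ℝ) ^ j * L + 2 ^ j * BB G L j θ * (2 * L) := by
  induction j with
  | zero => intro θ; simp [AA, BB]
  | succ j ih =>
    intro θ
    have h1 := even_sum_le (fun k => AA G L j (k * θ))
      (fun k => by push_cast; rw [neg_mul, AA_neg hGn]) (fun k => AA_nonneg hG L j _) L
    have h2 := AA_at_zero L hG hG0 j
    simp only [Int.cast_zero, zero_mul, Int.cast_natCast] at h1
    have h3 : (∑ k ∈ Finset.Icc 1 L, AA G L j (k * θ)) * (2 * L) ≤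
        ∑ k ∈ Finset.Icc 1 L, (j * (2 * L : ℝ) ^ j * L + 2 ^ j * BB G L j (k * θ) * (2 * L)) := by
      rw [Finset.sum_mul]
      exact Finset.sum_le_sum (fun k _ => ih _)
    rw [Finset.sum_add_distrib, Finset.sum_const, Nat.card_Icc, ← Finset.sum_mul,
      ← Finset.mul_sum, nsmul_eq_mul] at h3
    simp only [Nat.add_sub_cancel] at h3
    have hL : (0:ℝ) ≤ L := by positivity
    calc AA G L (j+1) θ * (2 * L)
        ≤ (AA G L j 0 + 2 * ∑ k ∈ Finset.Icc 1 L, AA G L j (k * θ)) * (2 * L) := by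
          exact mul_le_mul_of_nonneg_right h1 (by positivity)
      _ = AA G L j 0 * (2 * L) + 2 * ((∑ k ∈ Finset.Icc 1 L, AA G L j (k * θ)) * (2 * L)) := by
          ring
      _ ≤ ((2 * L : ℝ) ^ j * L) * (2 * L) + 2 * (L * (j * (2 * L : ℝ) ^ j * L) +
            2 ^ j * (∑ k ∈ Finset.Icc 1 L, BB G L j (k * θ)) * (2 * L)) := by
          have := mul_le_mul_of_nonneg_right h2 (by positivity : (0:ℝ) ≤ 2 * L)
          linarith
      _ = _ := by rw [BB]; push_cast; ring

lemma sum_mul_le_divisors (g : ℕ → ℝ) (hg : ∀ n, 0 ≤ g n) (A B : ℕ) :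
    ∑ k ∈ Finset.Icc 1 A, ∑ m ∈ Finset.Icc 1 B, g (m * k) ≤
      ∑ n ∈ Finset.Icc 1 (B * A), (n.divisors.card : ℝ) * g n := by
  rw [← Finset.sum_product']
  have hmap : ∀ x ∈ Finset.Icc 1 A ×ˢ Finset.Icc 1 B, x.2 * x.1 ∈ Finset.Icc 1 (B * A) := by
    rintro ⟨k, m⟩ hx
    simp only [Finset.mem_product, Finset.mem_Icc] at hx ⊢
    exact ⟨Nat.mul_pos (by omega) (by omega), Nat.mul_le_mul hx.2.2 hx.1.2⟩
  rw [← Finset.sum_fiberwise_of_maps_to hmap]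
  refine Finset.sum_le_sum (fun n hn => ?_)
  have hn0 : n ≠ 0 := by simp at hn; omega
  rw [Finset.sum_congr rfl (g := fun _ => g n)
    (fun x hx => by rw [(Finset.mem_filter.mp hx).2]), Finset.sum_const, nsmul_eq_mul]
  refine mul_le_mul_of_nonneg_right ?_ (hg n)
  norm_cast
  refine Finset.card_le_card_of_injOn (fun x => x.1) ?_ ?_
  · rintro ⟨k, m⟩ hx
    have hx' := Finset.mem_filter.mp hx
    simp only [Finset.mem_coe, Nat.mem_divisors]
    exact ⟨⟨m, by rw [← hx'.2]; ring⟩, hn0⟩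
  · rintro ⟨k, m⟩ hx ⟨k', m'⟩ hx' hk
    have h1 := Finset.mem_filter.mp hx
    have h2 := Finset.mem_filter.mp hx'
    simp only at hk; subst hk
    have h3 : m * k = m' * k := h1.2.trans h2.2.symm
    have hk : 0 < k := by
      have := h1.1; simp only [Finset.mem_product, Finset.mem_Icc] at this; omega
    rw [Nat.eq_of_mul_eq_mul_right hk h3]

lemma BB_le {G : ℝ → ℝ} (L : ℕ) (hL : 1 ≤ L) (hG : ∀ x, 0 ≤ G x) (T : ℝ) (hT0 : 0 ≤ T) (J : ℕ)
    (hT : ∀ n : ℕ, 1 ≤ n → n ≤ L ^ J → (n.divisors.card : ℝ) ≤ T) (j : ℕ) (hj : j ≤ J) : ∀ θ,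
    BB G L j θ ≤ T ^ j * ∑ m ∈ Finset.Icc 1 (L ^ j), G (m * θ) := by
  induction j with
  | zero => intro θ; simp [BB]
  | succ j ih =>
    intro θ
    rw [BB]
    calc ∑ k ∈ Finset.Icc 1 L, BB G L j (k * θ)
        ≤ ∑ k ∈ Finset.Icc 1 L, T ^ j * ∑ m ∈ Finset.Icc 1 (L ^ j), G (m * (k * θ)) :=
          Finset.sum_le_sum (fun k _ => ih (by omega) _)
      _ = T ^ j * ∑ k ∈ Finset.Icc 1 L, ∑ m ∈ Finset.Icc 1 (L ^ j), G ((m * k : ℕ) * θ) := by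
          rw [Finset.mul_sum]
          refine Finset.sum_congr rfl (fun k _ => ?_)
          congr 1
          refine Finset.sum_congr rfl (fun m _ => ?_)
          push_cast; rw [mul_assoc]
      _ ≤ T ^ j * ∑ n ∈ Finset.Icc 1 (L ^ j * L), (n.divisors.card : ℝ) * G (n * θ) :=
          mul_le_mul_of_nonneg_left
            (sum_mul_le_divisors (fun n => G (n * θ)) (fun n => hG _) L (L ^ j)) (by positivity)
      _ ≤ T ^ j * ∑ n ∈ Finset.Icc 1 (L ^ j * L), T * G (n * θ) := by
          refine mul_le_mul_of_nonneg_left (Finset.sum_le_sum (fun n hn => ?_)) (by positivity)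
          rw [Finset.mem_Icc, ← pow_succ] at hn
          exact mul_le_mul_of_nonneg_right
            (hT n hn.1 (hn.2.trans (Nat.pow_le_pow_right hL hj))) (hG _)
      _ = _ := by rw [← Finset.mul_sum, ← pow_succ]; ring

lemma card_int_interval (s : Finset ℤ) (c R : ℝ) (hR : 0 ≤ R)
    (hs : ∀ z ∈ s, |(z : ℝ) - c| ≤ R) : (s.card : ℝ) ≤ 2 * R + 1 := by
  have hsub : s ⊆ Finset.Icc ⌈c - R⌉ ⌊c + R⌋ := by
    intro z hz
    have := abs_le.mp (hs z hz)
    rw [Finset.mem_Icc, Int.ceil_le, Int.le_floor]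
    constructor <;> linarith [this.1, this.2]
  have h1 := Finset.card_le_card hsub
  rw [Int.card_Icc] at h1
  have h2 : ((⌊c + R⌋ + 1 - ⌈c - R⌉).toNat : ℝ) ≤ 2 * R + 1 := by
    rcases le_or_gt 0 (⌊c + R⌋ + 1 - ⌈c - R⌉) with h | h
    · have : (((⌊c + R⌋ + 1 - ⌈c - R⌉).toNat : ℤ) : ℝ) = ((⌊c + R⌋ + 1 - ⌈c - R⌉ : ℤ) : ℝ) := by
        rw [Int.toNat_of_nonneg h]
      rw [Int.cast_natCast] at this
      rw [this]; push_cast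
      have := Int.floor_le (c + R); have := Int.le_ceil (c - R)
      linarith
    · rw [Int.toNat_of_nonpos h.le]; simp; linarith
  have h3 : (s.card : ℝ) ≤ ((⌊c + R⌋ + 1 - ⌈c - R⌉).toNat : ℝ) := by exact_mod_cast h1
  linarith

lemma count_block (q : ℕ) (hq : 1 ≤ q) (a : ℤ) (hgcd : Int.gcd (q : ℤ) a = 1) (y : ℝ)
    (hy : |y - a / q| ≤ 1 / (q : ℝ) ^ 2) (δ : ℝ) (hδ : 0 < δ) (m0 : ℕ) :
    (((Finset.range q).filter (fun i : ℕ => nd (((m0 + i : ℕ) : ℝ) * y) < δ)).card : ℝ) ≤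
      2 * δ * q + 3 := by
  set s := (Finset.range q).filter (fun i : ℕ => nd (((m0 + i : ℕ) : ℝ) * y) < δ) with hs
  have hq0 : (0:ℝ) < q := by exact_mod_cast hq
  set F : ℕ → ℤ := fun i => i * a - round (((m0 + i : ℕ) : ℝ) * y) * q with hF
  have hinj : Set.InjOn F s := by
    intro i hi i' hi' h
    simp only [hF] at h
    have hi := (Finset.mem_filter.mp hi).1
    have hi' := (Finset.mem_filter.mp hi').1
    rw [Finset.mem_range] at hi hi'
    have hd : (q : ℤ) ∣ ((i : ℤ) - i') * a :=
      ⟨round (((m0 + i : ℕ) : ℝ) * y) - round (((m0 + i' : ℕ) : ℝ) * y), by linarith⟩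
    have hd2 : (q : ℤ) ∣ (i : ℤ) - i' := Int.dvd_of_dvd_mul_left_of_gcd_one hd hgcd
    have : (i : ℤ) - i' = 0 := by
      apply Int.eq_zero_of_abs_lt_dvd hd2
      rw [abs_lt]; omega
    omega
  rw [← Finset.card_image_of_injOn hinj]
  refine (card_int_interval _ (-(m0 * y * q)) (δ * q + 1) (by positivity) ?_).trans (by linarith)
  intro z hz
  obtain ⟨i, hi, rfl⟩ := Finset.mem_image.mp hz
  obtain ⟨hi1, hi2⟩ := Finset.mem_filter.mp hi
  rw [Finset.mem_range] at hi1
  unfold nd at hi2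
  set w := round (((m0 + i : ℕ) : ℝ) * y) with hw
  have e1 : ((F i : ℤ) : ℝ) - -(m0 * y * q) =
      (((m0 + i : ℕ) : ℝ) * y - w) * q - i * q * (y - a / q) := by
    simp only [hF, ← hw]; push_cast; field_simp; ring
  rw [e1]
  refine (abs_sub _ _).trans ?_
  rw [abs_mul, abs_mul, abs_mul, abs_of_pos hq0, Nat.abs_cast]
  have h1 : |((m0 + i : ℕ) : ℝ) * y - w| * q ≤ δ * q := by gcongr
  have h2 : (i : ℝ) * q * |y - a / q| ≤ 1 := by
    have : (i : ℝ) ≤ q := by exact_mod_cast hi1.le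
    calc (i : ℝ) * q * |y - a / q| ≤ q * q * (1 / (q : ℝ) ^ 2) := by gcongr
      _ = 1 := by field_simp
  linarith

lemma sum_range_mul' (g : ℕ → ℝ) (q K : ℕ) :
    ∑ m ∈ Finset.range (q * K), g m = ∑ b ∈ Finset.range K, ∑ i ∈ Finset.range q, g (q * b + i) := by
  induction K with
  | zero => simp
  | succ K ih => rw [Nat.mul_succ, Finset.sum_range_add, ih, Finset.sum_range_succ]

lemma GG_sum (q : ℕ) (hq : 1 ≤ q) (a : ℤ) (hgcd : Int.gcd (q : ℤ) a = 1) (y : ℝ)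
    (hy : |y - a / q| ≤ 1 / (q : ℝ) ^ 2) (δ : ℝ) (hδ : 0 < δ) (L M : ℕ) :
    ∑ m ∈ Finset.Icc 1 M, GG L δ (m * y) ≤
      ((M : ℝ) / q + 1) * (L * (2 * δ * q + 3) + q / δ) := by
  have hq0 : (0:ℝ) < q := by exact_mod_cast hq
  have hsub : Finset.Icc 1 M ⊆ Finset.range (q * (M / q + 1)) := by
    intro m hm
    rw [Finset.mem_Icc] at hm
    rw [Finset.mem_range]
    have := Nat.lt_mul_div_succ M (by omega : 0 < q)
    omega
  refine (Finset.sum_le_sum_of_subset_of_nonneg hsub (fun _ _ _ => GG_nonneg L hδ _)).trans ?_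
  rw [sum_range_mul' (fun m => GG L δ (m * y))]
  have hblock : ∀ b ∈ Finset.range (M / q + 1),
      ∑ i ∈ Finset.range q, GG L δ ((q * b + i : ℕ) * y) ≤ L * (2 * δ * q + 3) + q / δ := by
    intro b _
    have hc := count_block q hq a hgcd y hy δ hδ (q * b)
    unfold GG
    rw [Finset.sum_ite, Finset.sum_const, Finset.sum_const, nsmul_eq_mul, nsmul_eq_mul]
    have h2 : ((((Finset.range q).filter
        (fun i : ℕ => ¬ nd (((q * b + i : ℕ) : ℝ) * y) < δ)).card : ℕ) : ℝ) ≤ q := by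
      have := Finset.card_filter_le (Finset.range q)
        (fun i : ℕ => ¬ nd (((q * b + i : ℕ) : ℝ) * y) < δ)
      rw [Finset.card_range] at this
      exact_mod_cast this
    have h3 := mul_le_mul_of_nonneg_right hc (by positivity : (0:ℝ) ≤ L)
    have h4 := mul_le_mul_of_nonneg_right h2 (by positivity : (0:ℝ) ≤ 1 / δ)
    calc _ ≤ (2 * δ * q + 3) * L + q * (1 / δ) := add_le_add h3 h4
      _ = _ := by ring
  refine (Finset.sum_le_sum hblock).trans ?_
  rw [Finset.sum_const, Finset.card_range, nsmul_eq_mul]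
  refine mul_le_mul_of_nonneg_right ?_ (by positivity)
  push_cast
  have := @Nat.cast_div_le ℝ _ _ _ M q
  linarith

lemma divisor_bound (η : ℝ) (hη : 0 < η) : ∃ C : ℝ, 1 ≤ C ∧ ∀ n : ℕ, 1 ≤ n →
    (n.divisors.card : ℝ) ≤ C * (n : ℝ) ^ η := by
  have hlog : 0 < Real.log 2 := Real.log_pos (by norm_num)
  set c : ℝ := 1 + 1 / (η * Real.log 2) with hc
  have hc1 : 1 ≤ c := by rw [hc]; have : 0 < 1 / (η * Real.log 2) := by positivity
                         linarith
  set B : ℕ := ⌈(2:ℝ) ^ (1 / η)⌉₊ with hB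
  refine ⟨c ^ B, one_le_pow₀ hc1, fun n hn => ?_⟩
  have hn0 : n ≠ 0 := by omega
  have hfac : (n : ℝ) ^ η = ∏ p ∈ n.primeFactors, (((p : ℝ) ^ (n.factorization p)) ^ η) := by
    conv_lhs => rw [← Nat.prod_factorization_pow_eq_self hn0]
    rw [Finsupp.prod, Nat.support_factorization]
    push_cast
    rw [Real.finsetProd_rpow _ _ (fun i _ => by positivity)]
  have hterm : ∀ p ∈ n.primeFactors, ((n.factorization p + 1 : ℕ) : ℝ) ≤
      (if p < B then c else 1) * ((p : ℝ) ^ (n.factorization p)) ^ η := by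
    intro p hp
    have hp2 : (2:ℝ) ≤ p := by exact_mod_cast (Nat.prime_of_mem_primeFactors hp).two_le
    set v := n.factorization p with hv
    push_cast
    have hcomm : ((p : ℝ) ^ v) ^ η = ((p:ℝ) ^ η) ^ v := by
      rw [← Real.rpow_natCast, ← Real.rpow_natCast, ← Real.rpow_mul (by positivity),
        ← Real.rpow_mul (by positivity), mul_comm]
    rw [hcomm]
    split_ifs with h
    · have h1 : 1 + v * (η * Real.log 2) ≤ ((p:ℝ) ^ η) ^ v := by
        calc 1 + v * (η * Real.log 2) ≤ Real.exp (v * (η * Real.log 2)) := by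
              linarith [Real.add_one_le_exp (v * (η * Real.log 2))]
          _ = ((2:ℝ) ^ η) ^ v := by
              rw [Real.rpow_def_of_pos (by norm_num), ← Real.exp_nat_mul]; congr 1; ring
          _ ≤ _ := by gcongr
      have h2 : (v:ℝ) + 1 ≤ c * (1 + v * (η * Real.log 2)) := by
        have : c * (1 + v * (η * Real.log 2)) =
            1 + 1 / (η * Real.log 2) + v * (η * Real.log 2) + v := by
          rw [hc]; field_simp; ring
        rw [this]
        have : 0 < 1 / (η * Real.log 2) := by positivity
        have : 0 ≤ (v:ℝ) * (η * Real.log 2) := by positivity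
        linarith
      exact h2.trans (mul_le_mul_of_nonneg_left h1 (by linarith))
    · rw [one_mul]
      push Not at h
      have h1 : (2:ℝ) ≤ (p:ℝ) ^ η := by
        have : (2:ℝ) ^ (1 / η) ≤ p := (Nat.le_ceil _).trans (by exact_mod_cast h)
        calc (2:ℝ) = ((2:ℝ) ^ (1 / η)) ^ η := by
              rw [← Real.rpow_mul (by norm_num), one_div, inv_mul_cancel₀ hη.ne', Real.rpow_one]
          _ ≤ _ := by gcongr
      have h2 : (v:ℝ) + 1 ≤ 2 ^ v := by exact_mod_cast Nat.lt_two_pow_self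
      exact h2.trans (by gcongr)
  rw [Nat.card_divisors hn0, hfac]
  calc ((∏ x ∈ n.primeFactors, (n.factorization x + 1) : ℕ) : ℝ)
      = ∏ x ∈ n.primeFactors, ((n.factorization x + 1 : ℕ) : ℝ) := by push_cast; rfl
    _ ≤ ∏ p ∈ n.primeFactors, ((if p < B then c else 1) * ((p : ℝ) ^ (n.factorization p)) ^ η) :=
        Finset.prod_le_prod (fun _ _ => by positivity) hterm
    _ = (∏ p ∈ n.primeFactors, (if p < B then c else 1)) *
          ∏ p ∈ n.primeFactors, ((p : ℝ) ^ (n.factorization p)) ^ η := Finset.prod_mul_distrib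
    _ ≤ _ := by
        refine mul_le_mul_of_nonneg_right ?_ (Finset.prod_nonneg (fun _ _ => by positivity))
        rw [Finset.prod_ite, Finset.prod_const, Finset.prod_const_one, mul_one]
        refine pow_le_pow_right₀ hc1 ?_
        have : (n.primeFactors.filter (fun p => p < B)) ⊆ Finset.range B := by
          intro x hx; rw [Finset.mem_range]; exact (Finset.mem_filter.mp hx).2
        simpa using Finset.card_le_card this

lemma diff_poly (P : Polynomial ℚ) (j : ℕ) (hP : P.natDegree ≤ j + 1) (k : ℚ) :
    (Polynomial.taylor k P - P).natDegree ≤ j ∧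
      (Polynomial.taylor k P - P).coeff j = (j + 1) * k * P.coeff (j + 1) := by
  constructor
  · rw [Polynomial.natDegree_le_iff_coeff_eq_zero]
    intro N hN
    rw [Polynomial.coeff_sub, Polynomial.taylor_coeff]
    have h := Polynomial.natDegree_hasseDeriv_le P N
    rw [Polynomial.eval_eq_sum_range' (n := 1) (by omega)]
    simp [Polynomial.hasseDeriv_coeff]
  · rw [Polynomial.coeff_sub, Polynomial.taylor_coeff]
    have h := Polynomial.natDegree_hasseDeriv_le P j
    rw [Polynomial.eval_eq_sum_range' (n := 2) (by omega)]
    simp [Polynomial.hasseDeriv_coeff, Finset.sum_range_succ, add_comm 1 j]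
    ring

lemma pp_of_poly (j : ℕ) : ∀ (P : Polynomial ℚ), P.natDegree ≤ j + 1 → ∀ y : ℝ,
    PP j (fun n => ((P.eval (n : ℚ) : ℚ) : ℝ) * y)
      ((((j + 1).factorial * P.coeff (j + 1) : ℚ) : ℝ) * y) := by
  induction j with
  | zero =>
    intro P hP y n
    simp only
    rw [Polynomial.eval_eq_sum_range' (n := 2) (by omega),
      Polynomial.eval_eq_sum_range' (n := 2) (by omega)]
    simp [Finset.sum_range_succ]
    ring
  | succ j ih =>
    intro P hP y k
    obtain ⟨h1, h2⟩ := diff_poly P (j + 1) hP k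
    have := ih _ h1 y
    rw [h2] at this
    convert this using 1
    · funext n
      rw [Polynomial.eval_sub, Polynomial.taylor_eval]
      push_cast; ring
    · rw [Nat.factorial_succ (j + 1)]; push_cast; ring

lemma int_of_poly (j : ℕ) : ∀ (P : Polynomial ℚ), P.natDegree ≤ j →
    (∀ n : ℤ, ∃ z : ℤ, (z : ℚ) = P.eval (n : ℚ)) →
    ∃ D : ℤ, (D : ℚ) = j.factorial * P.coeff j := by
  induction j with
  | zero =>
    intro P hP hz
    obtain ⟨z, hz⟩ := hz 0
    refine ⟨z, ?_⟩
    rw [hz, Polynomial.eval_eq_sum_range' (n := 1) (by omega)]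
    simp
  | succ j ih =>
    intro P hP hz
    obtain ⟨h1, h2⟩ := diff_poly P j hP 1
    obtain ⟨D, hD⟩ := ih _ h1 (fun n => by
      obtain ⟨z1, hz1⟩ := hz (n + 1)
      obtain ⟨z2, hz2⟩ := hz n
      refine ⟨z1 - z2, ?_⟩
      rw [Polynomial.eval_sub, Polynomial.taylor_eval]
      push_cast at hz1 hz2 ⊢
      rw [hz1, hz2])
    refine ⟨D, ?_⟩
    rw [hD, h2, Nat.factorial_succ]; push_cast; ring

lemma period_of_poly (P : Polynomial ℚ) (f : ℤ → ℤ) (hfP : ∀ ℓ : ℤ, (f ℓ : ℚ) = P.eval (ℓ : ℚ)) :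
    ∃ K : ℕ, 1 ≤ K ∧ ∀ q n : ℤ, q ∣ f (n + K * q) - f n := by
  obtain ⟨b, hb, h⟩ := IsLocalization.integerNormalization_spec (nonZeroDivisors ℤ) P
  set Q := IsLocalization.integerNormalization (nonZeroDivisors ℤ) P
  have hb0 : b ≠ 0 := nonZeroDivisors.ne_zero hb
  have hev : ∀ n : ℤ, Q.eval n = b * f n := by
    intro n
    have h1 : (Polynomial.map (algebraMap ℤ ℚ) Q).eval (n : ℚ) = b * f n := by
      rw [h, hfP]; simp
    have h2 : (Polynomial.map (algebraMap ℤ ℚ) Q).eval (n : ℚ) = ((Q.eval n : ℤ) : ℚ) := by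
      simp
    rw [h2] at h1
    exact_mod_cast h1
  refine ⟨b.natAbs, by omega, fun q n => ?_⟩
  have h3 := Polynomial.sub_dvd_eval_sub (n + b.natAbs * q) n Q
  rw [hev, hev, ← mul_sub, add_sub_cancel_left] at h3
  have h4 : b * q ∣ b * (f (n + b.natAbs * q) - f n) := by
    refine dvd_trans (mul_dvd_mul_right ?_ q) h3
    exact Int.dvd_natAbs.mpr dvd_rfl
  exact (mul_dvd_mul_iff_left hb0).mp h4

lemma variation_of_poly (P : Polynomial ℚ) (j : ℕ) (hP : P.natDegree ≤ j + 1) (f : ℤ → ℤ)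
    (hfP : ∀ ℓ : ℤ, (f ℓ : ℚ) = P.eval (ℓ : ℚ)) :
    ∃ V : ℝ, 0 ≤ V ∧ ∀ L b n : ℕ, b ≤ n → n ≤ L →
      |(f n : ℝ) - f b| ≤ V * (n - b) * (L : ℝ) ^ j := by
  refine ⟨∑ i ∈ Finset.range (j + 2), |(P.coeff i : ℝ)| * i,
    Finset.sum_nonneg (fun _ _ => by positivity), fun L b n hbn hnL => ?_⟩
  have hf : ∀ m : ℕ, (f m : ℝ) = ∑ i ∈ Finset.range (j + 2), (P.coeff i : ℝ) * (m : ℝ) ^ i := by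
    intro m
    have h1 := hfP m
    rw [Polynomial.eval_eq_sum_range' (n := j + 2) (by omega)] at h1
    have h2 : (((f m : ℤ) : ℚ) : ℝ) = ((∑ i ∈ Finset.range (j + 2), P.coeff i * ((m : ℤ) : ℚ) ^ i : ℚ) : ℝ) := by
      rw [h1]
    push_cast at h2
    exact h2
  rw [hf, hf, ← Finset.sum_sub_distrib, Finset.sum_mul, Finset.sum_mul]
  refine (Finset.abs_sum_le_sum_abs _ _).trans (Finset.sum_le_sum (fun i hi => ?_))
  rw [← mul_sub, abs_mul, mul_assoc, mul_assoc]
  refine mul_le_mul_of_nonneg_left ?_ (abs_nonneg _)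
  have hbn' : (b : ℝ) ≤ n := by exact_mod_cast hbn
  have hnL' : (n : ℝ) ≤ L := by exact_mod_cast hnL
  rcases Nat.eq_zero_or_pos i with rfl | hi0
  · simp
  rcases Nat.eq_zero_or_pos n with rfl | hn0
  · have : b = 0 := by omega
    subst this; simp
  have hL1 : (1 : ℝ) ≤ L := by exact_mod_cast (by omega : 1 ≤ L)
  refine (abs_pow_sub_pow_le _ _ _).trans ?_
  rw [Nat.abs_cast, Nat.abs_cast, max_eq_left hbn', abs_of_nonneg (by linarith)]
  rw [Finset.mem_range] at hi
  have h1 : (n : ℝ) ^ (i - 1) ≤ (L : ℝ) ^ j :=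
    (pow_le_pow_left₀ (by positivity) hnL' _).trans (pow_le_pow_right₀ hL1 (by omega))
  calc ((n : ℝ) - b) * i * (n : ℝ) ^ (i - 1) ≤ ((n : ℝ) - b) * i * (L : ℝ) ^ j :=
        mul_le_mul_of_nonneg_left h1 (mul_nonneg (by linarith) (by positivity))
    _ = _ := by ring

lemma sum_nat_int (g : ℤ → ℂ) (L : ℕ) :
    ∑ n ∈ Finset.Icc 1 L, g (n : ℤ) = ∑ n ∈ Finset.Ico (1:ℤ) (L + 1), g n := by
  refine Finset.sum_nbij' (fun n => (n : ℤ)) (fun n => n.toNat) ?_ ?_ ?_ ?_ ?_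
  · intro n hn; simp only [Finset.mem_Icc, Finset.mem_Ico] at hn ⊢; omega
  · intro n hn; simp only [Finset.mem_Icc, Finset.mem_Ico] at hn ⊢; omega
  · intro n hn; simp
  · intro n hn; simp only [Finset.mem_Ico] at hn; simp; omega
  · intro n hn; rfl

set_option maxHeartbeats 1000000 in
lemma weyl (j D : ℕ) (hj : 1 ≤ j) (hD : 1 ≤ D) (f : ℤ → ℤ)
    (hPP : ∀ y : ℝ, PP j (fun n => (f n : ℝ) * y) (D * y)) :
    ∃ C : ℝ, 1 ≤ C ∧ ∀ (L q : ℕ) (a : ℤ) (y : ℝ), 1 ≤ L → 1 ≤ q → Int.gcd (q : ℤ) a = 1 →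
      |y - a / q| ≤ 1 / (q : ℝ) ^ 2 →
      ‖∑ n ∈ Finset.Icc 1 L, ee ((f (n : ℤ) : ℝ) * y)‖ ^ (2 ^ j) ≤
        C * (L : ℝ) ^ (2 ^ j) * (L : ℝ) ^ (1 / 16 : ℝ) *
          (1 / q + 1 / √L + q / (√L * (L : ℝ) ^ j)) := by
  have hj0 : (0:ℝ) < j := by exact_mod_cast hj
  obtain ⟨C1, hC1, hdiv⟩ := divisor_bound (1 / (16 * j * j)) (by positivity)
  refine ⟨2 ^ (2 ^ j) * ((j + 6 * D) * C1 ^ j), ?_, ?_⟩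
  · have h1 : (1:ℝ) ≤ C1 ^ j := one_le_pow₀ hC1
    have h2 : (1:ℝ) ≤ 2 ^ (2 ^ j) := one_le_pow₀ (by norm_num)
    have h3 : (1:ℝ) ≤ j + 6 * D := by
      have : (1:ℝ) ≤ j := by exact_mod_cast hj
      have : (0:ℝ) ≤ D := by positivity
      linarith
    exact one_le_mul_of_one_le_of_one_le h2 (one_le_mul_of_one_le_of_one_le h3 h1)
  intro L q a y hL hq hgcd hy
  rw [sum_nat_int (fun n => ee ((f n : ℝ) * y))]
  have hLr : (1:ℝ) ≤ L := by exact_mod_cast hL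
  have hL0 : (0:ℝ) < L := by linarith
  have hq0 : (0:ℝ) < q := by exact_mod_cast hq
  set s := √(L : ℝ) with hs
  have hs0 : 0 < s := Real.sqrt_pos.mpr hL0
  have hss : s * s = L := Real.mul_self_sqrt hL0.le
  have hs1 : 1 ≤ s := Real.one_le_sqrt.mpr hLr
  have hsL : s ≤ L := by nlinarith
  have hδ : 0 < 1 / s := by positivity
  have hW := weyl_diff hδ L hL j (fun n => (f n : ℝ) * y) (D * y) 1 (L + 1) (by simp) (hPP y)
  set x := ‖∑ n ∈ Finset.Ico (1:ℤ) (L + 1), ee ((f n : ℝ) * y)‖ with hx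
  have hG := GG_nonneg L hδ
  have hA := AA_le_BB (G := GG L (1/s)) L hG (GG_zero L hδ) (GG_neg L _) j (D * y)
  set T : ℝ := C1 * ((L : ℝ) ^ j) ^ (1 / (16 * j * j) : ℝ) with hT
  have hT0 : 0 ≤ T := by positivity
  have hB := BB_le (G := GG L (1/s)) L hL hG T hT0 j (fun n hn hn2 => by
    refine (hdiv n hn).trans ?_
    have : (n : ℝ) ≤ (L : ℝ) ^ j := by exact_mod_cast hn2
    rw [hT]; gcongr) j le_rfl (D * y)
  have hTj : T ^ j = C1 ^ j * (L : ℝ) ^ (1 / 16 : ℝ) := by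
    rw [hT, mul_pow]; congr 1
    rw [← Real.rpow_natCast, ← Real.rpow_natCast, ← Real.rpow_mul (by positivity),
      ← Real.rpow_mul (by positivity)]
    congr 1; field_simp
  set U := T ^ j with hU
  have hU1 : 1 ≤ U := by
    rw [hTj]
    exact one_le_mul_of_one_le_of_one_le (one_le_pow₀ hC1) (Real.one_le_rpow hLr (by norm_num))
  have hSg : ∑ m ∈ Finset.Icc 1 (L ^ j), GG L (1/s) (m * (D * y)) ≤
      (D * (L:ℝ) ^ j / q + 1) * (3 * L + 3 * q * s) := by
    have h1 : ∑ m ∈ Finset.Icc 1 (L ^ j), GG L (1/s) (m * (D * y)) ≤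
        ∑ m ∈ Finset.Icc 1 (D * L ^ j), GG L (1/s) (m * y) := by
      have himg : (Finset.Icc 1 (L ^ j)).image (fun m => m * D) ⊆ Finset.Icc 1 (D * L ^ j) := by
        intro m hm
        obtain ⟨m', hm', rfl⟩ := Finset.mem_image.mp hm
        rw [Finset.mem_Icc] at hm' ⊢
        exact ⟨Nat.mul_pos (by omega) (by omega),
          by rw [mul_comm]; exact Nat.mul_le_mul_left D hm'.2⟩
      refine le_trans (le_of_eq ?_)
        (Finset.sum_le_sum_of_subset_of_nonneg himg (fun _ _ _ => hG _))
      rw [Finset.sum_image (fun m _ m' _ h => Nat.eq_of_mul_eq_mul_right (by omega) h)]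
      refine Finset.sum_congr rfl (fun m _ => ?_)
      push_cast; rw [mul_assoc]
    refine h1.trans ((GG_sum q hq a hgcd y hy (1/s) hδ L (D * L ^ j)).trans (le_of_eq ?_))
    push_cast
    rw [← hss]; field_simp; ring
  set Sg := ∑ m ∈ Finset.Icc 1 (L ^ j), GG L (1/s) (m * (D * y)) with hSgdef
  set E : ℝ := 1 / q + 1 / s + q / (s * (L : ℝ) ^ j) with hE
  have hE1 : 0 < 1 / (q:ℝ) := by positivity
  have hE2 : 0 < 1 / s := hδ
  have hE3 : 0 < (q:ℝ) / (s * (L : ℝ) ^ j) := by positivity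
  have hE0 : 0 < E := by rw [hE]; positivity
  have hD1 : (1:ℝ) ≤ D := by exact_mod_cast hD
  have hSgE : Sg ≤ 6 * D * E * (L:ℝ) ^ (j + 1) := by
    have e1 : (D * (L:ℝ) ^ j / q + 1) * (3 * L + 3 * q * s) =
        (3 * D * (1 / q) + 3 * D * (1 / s) + 3 * (1 / (L:ℝ) ^ j) + 3 * (q / (s * (L : ℝ) ^ j))) *
          (L:ℝ) ^ (j + 1) := by
      rw [pow_succ, ← hss]; field_simp; ring
    have e2 : 1 / (L:ℝ) ^ j ≤ 1 / s := by
      apply one_div_le_one_div_of_le hs0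
      exact hsL.trans (le_self_pow₀ hLr (by omega))
    rw [e1] at hSg
    refine hSg.trans (mul_le_mul_of_nonneg_right ?_ (by positivity))
    rw [hE]
    nlinarith
  have hmain : x ^ (2 ^ j) * (2 * L : ℝ) ^ (j + 2) ≤
      (2 * L : ℝ) ^ (2 ^ j) * (j * (2 * L : ℝ) ^ j * L + 2 ^ j * (U * (6 * D * E * (L:ℝ) ^ (j + 1))) * (2 * L)) := by
    have hBB : BB (GG L (1/s)) L j (D * y) ≤ U * (6 * D * E * (L:ℝ) ^ (j + 1)) :=
      hB.trans (mul_le_mul_of_nonneg_left hSgE (by linarith))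
    have hAA : AA (GG L (1/s)) L j (D * y) * (2 * L) ≤
        j * (2 * L : ℝ) ^ j * L + 2 ^ j * (U * (6 * D * E * (L:ℝ) ^ (j + 1))) * (2 * L) := by
      refine hA.trans ?_
      gcongr
    calc x ^ (2 ^ j) * (2 * L : ℝ) ^ (j + 2) = x ^ (2 ^ j) * (2 * L : ℝ) ^ (j + 1) * (2 * L) := by
          ring
      _ ≤ (2 * L : ℝ) ^ (2 ^ j) * AA (GG L (1/s)) L j (D * y) * (2 * L) :=
          mul_le_mul_of_nonneg_right hW (by positivity)
      _ = (2 * L : ℝ) ^ (2 ^ j) * (AA (GG L (1/s)) L j (D * y) * (2 * L)) := by ring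
      _ ≤ _ := mul_le_mul_of_nonneg_left hAA (by positivity)
  have hfin : j * (2 * L : ℝ) ^ j * L + 2 ^ j * (U * (6 * D * E * (L:ℝ) ^ (j + 1))) * (2 * L) ≤
      ((j + 6 * D) * U * E) * (2 * L : ℝ) ^ (j + 2) := by
    have e1 : 2 ^ j * (U * (6 * D * E * (L:ℝ) ^ (j + 1))) * (2 * L) =
        (3 * D * U * E) * (2 * L : ℝ) ^ (j + 2) := by
      rw [mul_pow, pow_succ, pow_succ (2:ℝ) (j+1), pow_succ (2:ℝ) j, pow_succ (L:ℝ) (j+1)]; ring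
    have e2 : j * (2 * L : ℝ) ^ j * L ≤ (j * (U * E)) * (2 * L : ℝ) ^ (j + 2) := by
      have h1 : 1 / (L:ℝ) ≤ U * E := by
        have : 1 / (L:ℝ) ≤ 1 / s := one_div_le_one_div_of_le hs0 hsL
        have : 1 / s ≤ E := by rw [hE]; linarith
        nlinarith
      have h2 : (1:ℝ) ≤ U * E * L := by
        rwa [div_le_iff₀ hL0] at h1
      have h3 : (0:ℝ) ≤ j * (2 * L : ℝ) ^ j * L := by positivity
      calc j * (2 * L : ℝ) ^ j * L ≤ j * (2 * L : ℝ) ^ j * L * (4 * (U * E * L)) :=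
            le_mul_of_one_le_right h3 (by linarith)
        _ = _ := by rw [pow_succ, pow_succ]; ring
    rw [e1]
    have e3 : (0:ℝ) ≤ (3 * D * U * E) * (2 * L : ℝ) ^ (j + 2) := by positivity
    have e4 : ((j + 6 * D) * U * E) * (2 * L : ℝ) ^ (j + 2) =
        (j * (U * E)) * (2 * L : ℝ) ^ (j + 2) + 2 * ((3 * D * U * E) * (2 * L : ℝ) ^ (j + 2)) := by
      ring
    rw [e4]
    linarith only [e2, e3]
  have hpos : (0:ℝ) < (2 * L : ℝ) ^ (j + 2) := by positivity
  have hlast : x ^ (2 ^ j) ≤ (2 * L : ℝ) ^ (2 ^ j) * ((j + 6 * D) * U * E) := by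
    refine le_of_mul_le_mul_right ?_ hpos
    refine hmain.trans ?_
    rw [mul_assoc ((2 * L : ℝ) ^ (2 ^ j))]
    exact mul_le_mul_of_nonneg_left hfin (by positivity)
  refine hlast.trans (le_of_eq ?_)
  rw [hTj, mul_pow]; ring

lemma sum_range_mulC (g : ℕ → ℂ) (q K : ℕ) :
    ∑ m ∈ Finset.range (q * K), g m = ∑ b ∈ Finset.range K, ∑ i ∈ Finset.range q, g (q * b + i) := by
  induction K with
  | zero => simp
  | succ K ih => rw [Nat.mul_succ, Finset.sum_range_add, ih, Finset.sum_range_succ]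

lemma sum_Icc_range (g : ℕ → ℂ) (L : ℕ) :
    ∑ n ∈ Finset.Icc 1 L, g n = ∑ n ∈ Finset.range L, g (n + 1) := by
  induction L with
  | zero => simp
  | succ L ih => rw [Finset.sum_Icc_succ_top (by omega), ih, Finset.sum_range_succ]

lemma major (f : ℤ → ℤ) (K j : ℕ) (hK : 1 ≤ K) (hper : ∀ q n : ℤ, q ∣ f (n + K * q) - f n)
    (V : ℝ) (hV0 : 0 ≤ V) (hV : ∀ L b n : ℕ, b ≤ n → n ≤ L →
      |(f n : ℝ) - f b| ≤ V * (n - b) * (L : ℝ) ^ j)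
    (L q : ℕ) (hq : 1 ≤ q) (a : ℤ) (y : ℝ) :
    ‖∑ n ∈ Finset.Icc 1 L, ee ((f (n : ℤ) : ℝ) * y)‖ ≤
      L * (‖∑ n ∈ Finset.Icc 1 (K * q), ee ((f (n : ℤ) : ℝ) * (a / q))‖ / (K * q : ℕ)) +
        L * (2 * Real.pi * (V * (K * q : ℕ) * (L : ℝ) ^ j * |y - a / q|)) + (K * q : ℕ) := by
  rw [sum_Icc_range (fun n => ee ((f (n : ℤ) : ℝ) * y)),
    sum_Icc_range (fun n => ee ((f (n : ℤ) : ℝ) * (a / q)))]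
  set M := K * q with hM
  have hM1 : 1 ≤ M := Nat.mul_pos hK hq
  have hM0 : (0:ℝ) < M := by exact_mod_cast hM1
  have hq0 : (q:ℝ) ≠ 0 := by positivity
  set β := y - a / q with hβ
  set W := ‖∑ n ∈ Finset.range M, ee ((f ((n + 1 : ℕ) : ℤ) : ℝ) * (a / q))‖ with hW
  set ε := 2 * Real.pi * (V * M * (L : ℝ) ^ j * |β|) with hε
  have hε0 : 0 ≤ ε := by positivity
  have hLM : L = M * (L / M) + L % M := (Nat.div_add_mod L M).symm
  have hBM : M * (L / M) ≤ L := Nat.mul_div_le L M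
  have hsplit : ∑ n ∈ Finset.range L, ee ((f ((n + 1 : ℕ) : ℤ) : ℝ) * y) =
      ∑ b ∈ Finset.range (L / M), ∑ i ∈ Finset.range M,
        ee ((f ((M * b + i + 1 : ℕ) : ℤ) : ℝ) * y) +
      ∑ i ∈ Finset.range (L % M), ee ((f ((M * (L / M) + i + 1 : ℕ) : ℤ) : ℝ) * y) := by
    conv_lhs => rw [hLM]
    rw [Finset.sum_range_add, sum_range_mulC]
  have hblock : ∀ b ∈ Finset.range (L / M),
      ‖∑ i ∈ Finset.range M, ee ((f ((M * b + i + 1 : ℕ) : ℤ) : ℝ) * y)‖ ≤ W + M * ε := by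
    intro b hb
    rw [Finset.mem_range] at hb
    have hb' : M * b + M ≤ L := by
      have : M * (b + 1) ≤ M * (L / M) := Nat.mul_le_mul_left M hb
      rw [Nat.mul_succ] at this; omega
    set c := ee ((f ((M * b : ℕ) : ℤ) : ℝ) * β) with hc
    have hperi : ∀ i : ℕ, ee ((f ((M * b + i + 1 : ℕ) : ℤ) : ℝ) * (a / q)) =
        ee ((f ((i + 1 : ℕ) : ℤ) : ℝ) * (a / q)) := by
      intro i
      obtain ⟨z, hz⟩ := hper (q * b) ((i + 1 : ℕ) : ℤ)
      have e1 : (((i + 1 : ℕ) : ℤ) + K * (q * b)) = ((M * b + i + 1 : ℕ) : ℤ) := by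
        rw [hM]; push_cast; ring
      rw [e1] at hz
      have e2 : ((f ((M * b + i + 1 : ℕ) : ℤ) : ℤ) : ℝ) = f ((i + 1 : ℕ) : ℤ) + q * b * z := by
        have : f ((M * b + i + 1 : ℕ) : ℤ) = f ((i + 1 : ℕ) : ℤ) + q * b * z := by linarith
        rw [this]; push_cast; ring
      rw [e2]
      have e3 : ((f ((i + 1 : ℕ) : ℤ) : ℝ) + q * b * z) * (a / q) =
          (f ((i + 1 : ℕ) : ℤ) : ℝ) * (a / q) + ((b * z * a : ℤ) : ℝ) := by
        push_cast; field_simp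
      rw [e3, ee_add_int]
    have hterm : ∀ i ∈ Finset.range M, ‖ee ((f ((M * b + i + 1 : ℕ) : ℤ) : ℝ) * y) -
        ee ((f ((i + 1 : ℕ) : ℤ) : ℝ) * (a / q)) * c‖ ≤ ε := by
      intro i hi
      rw [Finset.mem_range] at hi
      rw [← hperi, hc, ← ee_add]
      refine (norm_ee_sub_ee_le _ _).trans ?_
      rw [hε]
      refine mul_le_mul_of_nonneg_left ?_ (by positivity)
      have e1 : (f ((M * b + i + 1 : ℕ) : ℤ) : ℝ) * y - ((f ((M * b + i + 1 : ℕ) : ℤ) : ℝ) * (a / q) +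
          (f ((M * b : ℕ) : ℤ) : ℝ) * β) =
          ((f ((M * b + i + 1 : ℕ) : ℤ) : ℝ) - f ((M * b : ℕ) : ℤ)) * β := by rw [hβ]; ring
      rw [e1, abs_mul]
      refine mul_le_mul_of_nonneg_right ?_ (abs_nonneg _)
      refine (hV L (M * b) (M * b + i + 1) (by omega) (by omega)).trans ?_
      have : ((M * b + i + 1 : ℕ) : ℝ) - ((M * b : ℕ) : ℝ) ≤ M := by
        have : ((i + 1 : ℕ) : ℝ) ≤ M := by exact_mod_cast hi
        push_cast at this ⊢; linarith
      gcongr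
    have hsum : ∑ i ∈ Finset.range M, ee ((f ((M * b + i + 1 : ℕ) : ℤ) : ℝ) * y) =
        (∑ i ∈ Finset.range M, ee ((f ((i + 1 : ℕ) : ℤ) : ℝ) * (a / q))) * c +
        ∑ i ∈ Finset.range M, (ee ((f ((M * b + i + 1 : ℕ) : ℤ) : ℝ) * y) -
          ee ((f ((i + 1 : ℕ) : ℤ) : ℝ) * (a / q)) * c) := by
      rw [Finset.sum_sub_distrib, Finset.sum_mul]; ring
    rw [hsum]
    refine (norm_add_le _ _).trans ?_
    rw [norm_mul, hc, norm_ee, mul_one]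
    refine add_le_add le_rfl ((norm_sum_le _ _).trans ((Finset.sum_le_sum hterm).trans ?_))
    simp
  have hrem : ‖∑ i ∈ Finset.range (L % M), ee ((f ((M * (L / M) + i + 1 : ℕ) : ℤ) : ℝ) * y)‖ ≤ M := by
    refine (norm_sum_le _ _).trans ?_
    simp only [norm_ee, Finset.sum_const, Finset.card_range, nsmul_eq_mul, mul_one]
    exact_mod_cast (Nat.mod_lt L (by omega)).le
  rw [hsplit]
  refine (norm_add_le _ _).trans (add_le_add ?_ hrem)
  refine (norm_sum_le _ _).trans ((Finset.sum_le_sum hblock).trans ?_)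
  rw [Finset.sum_const, Finset.card_range, nsmul_eq_mul]
  have hBM' : (M:ℝ) * ((L / M : ℕ) : ℝ) ≤ L := by exact_mod_cast hBM
  have hW0 : 0 ≤ W / M + ε := add_nonneg (div_nonneg (norm_nonneg _) hM0.le) hε0
  calc ((L / M : ℕ) : ℝ) * (W + M * ε) = (M * ((L / M : ℕ) : ℝ)) * (W / M + ε) := by field_simp
    _ ≤ L * (W / M + ε) := mul_le_mul_of_nonneg_right hBM' hW0
    _ = _ := by ring

lemma approx (j L h : ℕ) (hL : 1 ≤ L) (hL2 : (4:ℝ) ≤ (L:ℝ) ^ (1 / 16 : ℝ)) (d : ℤ) (y : ℝ)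
    (hgcd : Int.gcd (h : ℤ) d = 1) (h1 : 1 ≤ h) (hh : h ≤ L ^ j)
    (hy : |y - (d : ℝ) / h| < 1 / (h : ℝ) ^ 2) :
    ∃ (q : ℕ) (a : ℤ), 1 ≤ q ∧ Int.gcd (q : ℤ) a = 1 ∧ h ≤ 2 * q ∧
      (q : ℝ) ≤ (L : ℝ) ^ j * (L : ℝ) ^ (1 / 8 : ℝ) ∧
      |y - a / q| ≤ 1 / (q : ℝ) ^ 2 ∧
      |y - a / q| ≤ 1 / ((L : ℝ) ^ j * (L : ℝ) ^ (1 / 8 : ℝ) * q) := by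
  have hLr : (1:ℝ) ≤ L := by exact_mod_cast hL
  set X := (L : ℝ) ^ j * (L : ℝ) ^ (1 / 8 : ℝ) with hX
  have h8 : (4:ℝ) ≤ (L : ℝ) ^ (1 / 8 : ℝ) :=
    hL2.trans (Real.rpow_le_rpow_of_exponent_le hLr (by norm_num))
  have hhr : (h:ℝ) ≤ (L:ℝ) ^ j := by exact_mod_cast hh
  have hh0 : (0:ℝ) < h := by exact_mod_cast h1
  have hX2 : 2 * (h:ℝ) ≤ X := by rw [hX]; nlinarith
  have hX1 : 1 ≤ X := by
    have : (1:ℝ) ≤ h := by exact_mod_cast h1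
    linarith
  have hn : 0 < ⌊X⌋₊ := Nat.floor_pos.mpr hX1
  obtain ⟨α, hα1, hα2⟩ := Real.exists_rat_abs_sub_le_and_den_le y hn
  have hq1 : 1 ≤ α.den := α.den_pos
  have hq0 : (0:ℝ) < α.den := by exact_mod_cast hq1
  have hcast : (α : ℝ) = α.num / α.den := Rat.cast_def α
  rw [hcast] at hα1
  have hXn : X ≤ (⌊X⌋₊ : ℝ) + 1 := (Nat.lt_floor_add_one X).le
  have hqX : (α.den : ℝ) ≤ ⌊X⌋₊ := by exact_mod_cast hα2
  have hX0 : 0 < X := by linarith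
  have hb : |y - α.num / α.den| ≤ 1 / (X * α.den) :=
    hα1.trans (one_div_le_one_div_of_le (by positivity) (by gcongr))
  refine ⟨α.den, α.num, hq1, ?_, ?_, hqX.trans (Nat.floor_le hX0.le), ?_, hb⟩
  · rw [Int.gcd_comm]; exact α.reduced
  · by_cases he : d * (α.den : ℤ) - α.num * h = 0
    · have : (h : ℤ) ∣ d * (α.den : ℤ) := ⟨α.num, by linarith⟩
      have h2 : (h : ℤ) ∣ (α.den : ℤ) := Int.dvd_of_dvd_mul_right_of_gcd_one this hgcd
      have h3 : h ∣ α.den := by exact_mod_cast h2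
      have := Nat.le_of_dvd (by omega) h3
      omega
    · have h2 : (1:ℝ) ≤ |(d:ℝ) * α.den - α.num * h| := by
        have : (1:ℤ) ≤ |d * (α.den : ℤ) - α.num * h| := Int.one_le_abs he
        have h3 : ((1:ℤ):ℝ) ≤ ((|d * (α.den : ℤ) - α.num * h| : ℤ) : ℝ) := by exact_mod_cast this
        push_cast at h3; exact h3
      have h3 : (d:ℝ) * α.den - α.num * h = ((y - α.num / α.den) - (y - d / h)) * (h * α.den) := by
        field_simp; ring
      rw [h3, abs_mul, abs_of_pos (by positivity : (0:ℝ) < h * α.den)] at h2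
      have h4 : |(y - α.num / α.den) - (y - d / h)| < 1 / (X * α.den) + 1 / (h:ℝ) ^ 2 :=
        (abs_sub _ _).trans_lt (add_lt_add_of_le_of_lt hb hy)
      have h5 : (1:ℝ) < (1 / (X * α.den) + 1 / (h:ℝ) ^ 2) * (h * α.den) :=
        h2.trans_lt (mul_lt_mul_of_pos_right h4 (by positivity))
      have h6 : (1 / (X * α.den) + 1 / (h:ℝ) ^ 2) * (h * α.den) = h / X + α.den / h := by
        field_simp
      rw [h6] at h5
      have h7 : (h:ℝ) / X ≤ 1 / 2 := by rw [div_le_div_iff₀ hX0 (by norm_num)]; linarith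
      have h8 : (1:ℝ) / 2 < α.den / h := by linarith
      rw [div_lt_div_iff₀ (by norm_num) hh0] at h8
      have h9 : (h:ℝ) < 2 * α.den := by linarith
      have : h < 2 * α.den := by exact_mod_cast h9
      omega
  · refine hα1.trans (one_div_le_one_div_of_le (by positivity) ?_)
    rw [sq]; gcongr; linarith

lemma rpow_split (x : ℝ) (hx : 0 < x) (a b c : ℝ) (h : a + b = c) : x ^ a * x ^ b = x ^ c := by
  rw [← Real.rpow_add hx, h]

set_option maxHeartbeats 1000000 in
lemma minor_final (N j L q h : ℕ) (hN : 1 ≤ N) (κ : ℝ) (hκ : κ * N = 1 / 4) (C S : ℝ) (hC : 1 ≤ C)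
    (hL : 1 ≤ L) (hq : 1 ≤ q) (h1 : 1 ≤ h) (hLC : 4 * C ≤ (L:ℝ) ^ (1 / 16 : ℝ)) (hhq : h ≤ 2 * q)
    (hqX : (q : ℝ) ≤ (L : ℝ) ^ j * (L : ℝ) ^ (1 / 8 : ℝ)) (hqL : √(L:ℝ) ≤ q)
    (hS : S ^ N ≤ C * (L : ℝ) ^ N * (L : ℝ) ^ (1 / 16 : ℝ) *
          (1 / q + 1 / √L + q / (√L * (L : ℝ) ^ j))) :
    S ≤ (L:ℝ) ^ (1 - κ) + L * (h:ℝ) ^ (-κ) := by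
  have hLr : (1:ℝ) ≤ L := by exact_mod_cast hL
  have hL0 : (0:ℝ) < L := by linarith
  have hq0 : (0:ℝ) < q := by exact_mod_cast hq
  have hh0 : (0:ℝ) < h := by exact_mod_cast h1
  have hs0 : 0 < √(L:ℝ) := Real.sqrt_pos.mpr hL0
  set u := (L:ℝ) ^ (1 / 16 : ℝ) with hu
  have hu0 : 0 < u := by positivity
  have hu1 : 1 ≤ u := Real.one_le_rpow hLr (by norm_num)
  have up : ∀ n : ℕ, u ^ n = (L:ℝ) ^ ((n:ℝ) / 16) := by
    intro n; rw [hu, ← Real.rpow_natCast, ← Real.rpow_mul hL0.le]; congr 1; ring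
  have hsu : √(L:ℝ) = u ^ 8 := by rw [up, Real.sqrt_eq_rpow]; norm_num
  have h8u : (L:ℝ) ^ (1 / 8 : ℝ) = u ^ 2 := by rw [up]; norm_num
  have h4u : (L:ℝ) ^ (-(1 / 4) : ℝ) = 1 / u ^ 4 := by
    rw [up, Real.rpow_neg hL0.le, one_div]; norm_num
  -- second and third terms
  have t2 : q / (√L * (L : ℝ) ^ j) ≤ 1 / u ^ 6 := by
    rw [hsu, div_le_div_iff₀ (by positivity) (by positivity)]
    rw [h8u] at hqX
    calc (q:ℝ) * u ^ 6 ≤ ((L : ℝ) ^ j * u ^ 2) * u ^ 6 := by gcongr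
      _ = _ := by ring
  have t3 : 1 / √(L:ℝ) ≤ 1 / u ^ 6 := by
    rw [hsu]; apply one_div_le_one_div_of_le (by positivity)
    exact pow_le_pow_right₀ hu1 (by norm_num)
  have t4 : C * u * (1 / √(L:ℝ) + q / (√L * (L : ℝ) ^ j)) ≤ 1 / 2 * (L:ℝ) ^ (-(1 / 4) : ℝ) := by
    rw [h4u]
    calc C * u * (1 / √(L:ℝ) + q / (√L * (L : ℝ) ^ j)) ≤ C * u * (1 / u ^ 6 + 1 / u ^ 6) := by gcongr
      _ = 1 / 2 * ((4 * C) / u * (1 / u ^ 4)) := by field_simp; ring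
      _ ≤ 1 / 2 * (1 * (1 / u ^ 4)) := by
          gcongr; rw [div_le_one hu0]; exact hLC
      _ = _ := by ring
  have t1 : C * u * (1 / q) ≤ 1 / 2 * (h:ℝ) ^ (-(1 / 4) : ℝ) := by
    have hqu : u ^ 8 ≤ q := hsu ▸ hqL
    have hh : ((2 * q : ℝ)) ^ (-(1/4) : ℝ) ≤ (h:ℝ) ^ (-(1/4) : ℝ) := by
      apply Real.rpow_le_rpow_of_nonpos hh0 (by exact_mod_cast hhq) (by norm_num)
    refine le_trans ?_ (mul_le_mul_of_nonneg_left hh (by norm_num))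
    have h2q : ((2 * q : ℝ)) ^ (1/4 : ℝ) ≤ 2 * (q:ℝ) ^ (1 / 4 : ℝ) := by
      rw [Real.mul_rpow (by norm_num) hq0.le]
      gcongr
      calc (2:ℝ) ^ (1/4:ℝ) ≤ 2 ^ (1:ℝ) := Real.rpow_le_rpow_of_exponent_le (by norm_num) (by norm_num)
        _ = 2 := by norm_num
    set v := (q:ℝ) ^ (1 / 4 : ℝ) with hv
    have hv0 : 0 < v := by positivity
    have hv4 : v ^ 4 = q := by
      rw [hv, ← Real.rpow_natCast, ← Real.rpow_mul hq0.le]; norm_num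
    have huv : u ^ 2 ≤ v := by
      refine le_of_pow_le_pow_left₀ (n := 4) (by norm_num) hv0.le ?_
      rw [hv4, ← pow_mul]; exact hqu
    rw [Real.rpow_neg (by positivity), ← one_div]
    have h3 : 1 / (2 * v) ≤ 1 / ((2 * q : ℝ)) ^ (1/4 : ℝ) :=
      one_div_le_one_div_of_le (by positivity) h2q
    refine le_trans ?_ (mul_le_mul_of_nonneg_left h3 (by norm_num))
    rw [← hv4]
    have h4 : 4 * C * u ≤ v ^ 3 := by
      have a1 : 4 * C * u ≤ u ^ 2 := by nlinarith
      have a2 : 1 ≤ v := le_trans (one_le_pow₀ hu1) huv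
      have a3 : v ≤ v ^ 3 := le_self_pow₀ a2 (by norm_num)
      linarith
    have : C * u * (1 / v ^ 4) = (4 * C * u) * (1 / (4 * v ^ 4)) := by field_simp
    rw [this]
    calc (4 * C * u) * (1 / (4 * v ^ 4)) ≤ v ^ 3 * (1 / (4 * v ^ 4)) := by gcongr
      _ = 1 / 2 * (1 / (2 * v)) := by field_simp; norm_num
  -- combine
  set A := (L:ℝ) ^ (1 - κ) with hA
  set B := L * (h:ℝ) ^ (-κ) with hB
  have hA0 : 0 ≤ A := by positivity
  have hB0 : 0 ≤ B := by positivity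
  have hAN : A ^ N = (L:ℝ) ^ N * (L:ℝ) ^ (-(1/4) : ℝ) := by
    rw [hA, ← Real.rpow_natCast, ← Real.rpow_natCast, ← Real.rpow_mul hL0.le, ← Real.rpow_add hL0]
    congr 1; linarith
  have hBN : B ^ N = (L:ℝ) ^ N * (h:ℝ) ^ (-(1/4) : ℝ) := by
    rw [hB, mul_pow]; congr 1
    rw [← Real.rpow_natCast, ← Real.rpow_mul hh0.le]
    congr 1; linarith
  have hfin : S ^ N ≤ (A + B) ^ N := by
    have e1 : A ^ N ≤ (A + B) ^ N := pow_le_pow_left₀ hA0 (by linarith) N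
    have e2 : B ^ N ≤ (A + B) ^ N := pow_le_pow_left₀ hB0 (by linarith) N
    have e3 : S ^ N ≤ 1 / 2 * A ^ N + 1 / 2 * B ^ N := by
      rw [hAN, hBN]
      refine hS.trans ?_
      have e4 : C * (L : ℝ) ^ N * u * (1 / q + 1 / √L + q / (√L * (L : ℝ) ^ j)) =
          (L:ℝ) ^ N * (C * u * (1 / q) + C * u * (1 / √(L:ℝ) + q / (√L * (L : ℝ) ^ j))) := by ring
      rw [e4]
      have := mul_le_mul_of_nonneg_left (add_le_add t1 t4) (by positivity : (0:ℝ) ≤ (L:ℝ) ^ N)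
      linarith
    linarith
  exact le_of_pow_le_pow_left₀ (by omega) (by linarith) hfin

set_option maxHeartbeats 1000000 in
lemma major_final (N j K L q h : ℕ) (hN : 2 ≤ N) (hj : 1 ≤ j) (hK : 1 ≤ K) (κ : ℝ)
    (hκ : κ * N = 1 / 4) (C V S SM β : ℝ) (hC : 1 ≤ C) (hV : 0 ≤ V) (hβ : 0 ≤ β) (hSM0 : 0 ≤ SM)
    (hL : 1 ≤ L) (hq : 1 ≤ q) (h1 : 1 ≤ h)
    (hLC : 4 * (2 * Real.pi * V * K + K) ≤ (L:ℝ) ^ (1 / 16 : ℝ)) (hhq : h ≤ 2 * q)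
    (hqC : 6 * C * K * 2 ^ N ≤ (q:ℝ) ^ (3 / 16 : ℝ))
    (hqL : (q:ℝ) ≤ √(L:ℝ)) (hβ2 : β ≤ 1 / ((L : ℝ) ^ j * (L : ℝ) ^ (1 / 8 : ℝ) * q))
    (hS : S ≤ L * (SM / (K * q : ℕ)) +
        L * (2 * Real.pi * (V * (K * q : ℕ) * (L : ℝ) ^ j * β)) + (K * q : ℕ))
    (hSM : SM ^ N ≤ C * ((K * q : ℕ) : ℝ) ^ N * ((K * q : ℕ) : ℝ) ^ (1 / 16 : ℝ) *
          (1 / q + 1 / √((K * q : ℕ):ℝ) + q / (√((K * q : ℕ):ℝ) * ((K * q : ℕ) : ℝ) ^ j))) :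
    S ≤ (L:ℝ) ^ (1 - κ) + L * (h:ℝ) ^ (-κ) := by
  have hLr : (1:ℝ) ≤ L := by exact_mod_cast hL
  have hL0 : (0:ℝ) < L := by linarith
  have hqr : (1:ℝ) ≤ q := by exact_mod_cast hq
  have hq0 : (0:ℝ) < q := by linarith
  have hKr : (1:ℝ) ≤ K := by exact_mod_cast hK
  have hK0 : (0:ℝ) < K := by linarith
  have hhr : (1:ℝ) ≤ h := by exact_mod_cast h1
  have hh0 : (0:ℝ) < h := by linarith
  have hNr : (2:ℝ) ≤ N := by exact_mod_cast hN
  have hκ0 : 0 < κ := by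
    by_contra hc; push Not at hc; nlinarith
  have hκ8 : κ ≤ 1 / 8 := by nlinarith
  set M : ℝ := ((K * q : ℕ) : ℝ) with hM
  have hMe : M = K * q := by rw [hM]; push_cast; ring
  have hqM : (q:ℝ) ≤ M := by rw [hMe]; nlinarith
  have hM1 : 1 ≤ M := by linarith
  have hM0 : 0 < M := by linarith
  -- complete sum
  have hsq0 : 0 < √(q:ℝ) := Real.sqrt_pos.mpr hq0
  have hsM : √(q:ℝ) ≤ √M := Real.sqrt_le_sqrt hqM
  have hsM0 : 0 < √M := by linarith
  have hsq1 : √(q:ℝ) ≤ q := by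
    have := Real.mul_self_sqrt hq0.le
    have : 1 ≤ √(q:ℝ) := Real.one_le_sqrt.mpr hqr
    nlinarith
  have a1 : 1 / (q:ℝ) ≤ 1 / √(q:ℝ) := one_div_le_one_div_of_le hsq0 hsq1
  have a2 : 1 / √M ≤ 1 / √(q:ℝ) := one_div_le_one_div_of_le hsq0 hsM
  have a3 : q / (√M * M ^ j) ≤ 1 / √(q:ℝ) := by
    rw [div_le_div_iff₀ (by positivity) hsq0]
    have : M ≤ M ^ j := le_self_pow₀ hM1 (by omega)
    calc q * √(q:ℝ) ≤ M ^ j * √M := by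
          apply mul_le_mul (hqM.trans this) hsM hsq0.le (by positivity)
      _ = _ := by ring
  set u := (q:ℝ) ^ (1 / 16 : ℝ) with hu
  have hu0 : 0 < u := by positivity
  have up : ∀ n : ℕ, u ^ n = (q:ℝ) ^ ((n:ℝ) / 16) := by
    intro n; rw [hu, ← Real.rpow_natCast, ← Real.rpow_mul hq0.le]; congr 1; ring
  have hsu : √(q:ℝ) = u ^ 8 := by rw [up, Real.sqrt_eq_rpow]; norm_num
  have h3u : (q:ℝ) ^ (3 / 16 : ℝ) = u ^ 3 := by rw [up]; norm_num
  have h4u : (q:ℝ) ^ (1 / 4 : ℝ) = u ^ 4 := by rw [up]; norm_num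
  have hMu : M ^ (1 / 16 : ℝ) ≤ K * u := by
    rw [hMe, Real.mul_rpow hK0.le hq0.le]
    gcongr
    calc (K:ℝ) ^ (1/16:ℝ) ≤ (K:ℝ) ^ (1:ℝ) := Real.rpow_le_rpow_of_exponent_le hKr (by norm_num)
      _ = K := Real.rpow_one _
  have hcs : (SM / M) ^ N ≤ 3 * C * K / u ^ 7 := by
    rw [div_pow, div_le_iff₀ (by positivity)]
    refine hSM.trans ?_
    calc C * M ^ N * M ^ (1 / 16 : ℝ) * (1 / q + 1 / √M + q / (√M * M ^ j))
        ≤ C * M ^ N * (K * u) * (1 / √(q:ℝ) + 1 / √(q:ℝ) + 1 / √(q:ℝ)) := by gcongr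
      _ = _ := by rw [hsu]; field_simp; norm_num
  have hhκ : ((2 * q : ℝ)) ^ (-κ) ≤ (h:ℝ) ^ (-κ) :=
    Real.rpow_le_rpow_of_nonpos hh0 (by exact_mod_cast hhq) (by linarith)
  have hcs2 : SM / M ≤ 1 / 2 * (h:ℝ) ^ (-κ) := by
    refine le_trans ?_ (mul_le_mul_of_nonneg_left hhκ (by norm_num))
    refine le_of_pow_le_pow_left₀ (n := N) (by omega) (by positivity) ?_
    refine hcs.trans ?_
    rw [mul_pow, ← Real.rpow_natCast ((2 * q : ℝ) ^ (-κ)), ← Real.rpow_mul (by positivity),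
      neg_mul, hκ, Real.rpow_neg (by positivity)]
    have h2q : ((2 * q : ℝ)) ^ (1/4 : ℝ) ≤ 2 * u ^ 4 := by
      rw [Real.mul_rpow (by norm_num) hq0.le, h4u]
      gcongr
      calc (2:ℝ) ^ (1/4:ℝ) ≤ 2 ^ (1:ℝ) := Real.rpow_le_rpow_of_exponent_le (by norm_num) (by norm_num)
        _ = 2 := by norm_num
    have h3 : (2 * u ^ 4)⁻¹ ≤ (((2 * q : ℝ)) ^ (1/4 : ℝ))⁻¹ := by
      gcongr
    refine le_trans ?_ (mul_le_mul_of_nonneg_left h3 (by positivity))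
    rw [h3u] at hqC
    rw [div_pow, one_pow]
    rw [div_le_iff₀ (by positivity)]
    have : 1 / (2:ℝ) ^ N * (2 * u ^ 4)⁻¹ * u ^ 7 = u ^ 3 / (2 * 2 ^ N) := by field_simp
    rw [this, le_div_iff₀ (by positivity)]
    linarith
  -- error terms
  set w := (L:ℝ) ^ (1 / 16 : ℝ) with hw
  have hw0 : 0 < w := by positivity
  have hw1 : 1 ≤ w := Real.one_le_rpow hLr (by norm_num)
  have wp : ∀ n : ℕ, w ^ n = (L:ℝ) ^ ((n:ℝ) / 16) := by
    intro n; rw [hw, ← Real.rpow_natCast, ← Real.rpow_mul hL0.le]; congr 1; ring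
  have hsw : √(L:ℝ) = w ^ 8 := by rw [wp, Real.sqrt_eq_rpow]; norm_num
  have h8w : (L:ℝ) ^ (1 / 8 : ℝ) = w ^ 2 := by rw [wp]; norm_num
  have hLw : (L:ℝ) = w ^ 16 := by rw [wp]; norm_num
  have er1 : L * (2 * Real.pi * (V * M * (L : ℝ) ^ j * β)) ≤ 2 * Real.pi * V * K * w ^ 14 := by
    calc L * (2 * Real.pi * (V * M * (L : ℝ) ^ j * β))
        ≤ L * (2 * Real.pi * (V * M * (L : ℝ) ^ j *
            (1 / ((L : ℝ) ^ j * (L : ℝ) ^ (1 / 8 : ℝ) * q)))) := by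
          have := Real.pi_pos
          gcongr
      _ = 2 * Real.pi * V * K * (L / w ^ 2) := by rw [h8w, hMe]; field_simp
      _ = _ := by rw [hLw]; field_simp
  have er2 : M ≤ K * w ^ 14 := by
    rw [hMe]
    have : w ^ 8 ≤ w ^ 14 := pow_le_pow_right₀ hw1 (by norm_num)
    rw [hsw] at hqL
    gcongr
    linarith
  have hhw : 1 / (2 * w) ≤ (h:ℝ) ^ (-κ) := by
    have b1 : (h:ℝ) ^ (-(1/8) : ℝ) ≤ (h:ℝ) ^ (-κ) :=
      Real.rpow_le_rpow_of_exponent_le hhr (by linarith)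
    refine le_trans ?_ b1
    have b2 : (h:ℝ) ≤ 2 * w ^ 8 := by
      have : (h:ℝ) ≤ 2 * q := by exact_mod_cast hhq
      rw [hsw] at hqL; linarith
    rw [Real.rpow_neg hh0.le, ← one_div]
    apply one_div_le_one_div_of_le (by positivity)
    calc (h:ℝ) ^ (1/8:ℝ) ≤ (2 * w ^ 8) ^ (1/8:ℝ) := by gcongr
      _ = 2 ^ (1/8:ℝ) * (w ^ 8) ^ (1/8:ℝ) := Real.mul_rpow (by norm_num) (by positivity)
      _ = 2 ^ (1/8:ℝ) * w := by
          congr 1; rw [← Real.rpow_natCast, ← Real.rpow_mul hw0.le]; norm_num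
      _ ≤ 2 * w := by
          gcongr
          calc (2:ℝ) ^ (1/8:ℝ) ≤ 2 ^ (1:ℝ) :=
                Real.rpow_le_rpow_of_exponent_le (by norm_num) (by norm_num)
            _ = 2 := by norm_num
  have er3 : 2 * Real.pi * V * K * w ^ 14 + K * w ^ 14 ≤ 1 / 2 * (L * (h:ℝ) ^ (-κ)) := by
    have c1 : L * (1 / (2 * w)) ≤ L * (h:ℝ) ^ (-κ) := mul_le_mul_of_nonneg_left hhw hL0.le
    have c2 : L * (1 / (2 * w)) = w ^ 15 / 2 := by rw [hLw]; field_simp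
    have c3 : 4 * (2 * Real.pi * V * K + K) * w ^ 14 ≤ w * w ^ 14 := by gcongr
    have c4 : w * w ^ 14 = w ^ 15 := by ring
    have c7 : 2 * Real.pi * V * K * w ^ 14 + K * w ^ 14 =
        1 / 4 * (4 * (2 * Real.pi * V * K + K) * w ^ 14) := by ring
    rw [c7]
    rw [c2] at c1
    rw [c4] at c3
    linarith only [c1, c3]
  have c5 := mul_le_mul_of_nonneg_left hcs2 hL0.le
  have c6 : 0 ≤ (L:ℝ) ^ (1 - κ) := by positivity
  linarith only [hS, c5, c6, er1, er2, er3]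

end WeylAux

open WeylAux in
theorem stmt9 (r : ℕ) (hr : 1 ≤ r) (P : Polynomial ℚ) (hPdeg : P.natDegree = r)
    (hPlc : 0 < P.leadingCoeff)
    (f : ℤ → ℤ) (hfP : ∀ ℓ : ℤ, (f ℓ : ℚ) = P.eval (ℓ : ℚ))
    (hfpos : ∀ ℓ : ℤ, 1 ≤ ℓ → 0 < f ℓ)
    (hfprime : ∀ p : ℕ, p.Prime → ∃ ℓ : ℤ, ¬ ((p : ℤ) ∣ f ℓ)) :
    ∃ Cf : ℕ, ∃ L₀ : ℝ, 0 < Cf ∧ 0 < L₀ ∧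
      ∀ y : ℝ, ∀ h : ℕ, ∀ d : ℤ, ∀ L : ℕ, (L₀ : ℝ) ≤ L →
        Int.gcd (h : ℤ) d = 1 → Cf < h → h ≤ L ^ (r - 1) →
        |y - (d : ℝ) / (h : ℝ)| < 1 / (h : ℝ) ^ 2 →
        ‖∑ n ∈ Finset.Icc 1 L,
            Complex.exp (2 * Real.pi * Complex.I * (((f (n : ℤ) : ℝ) * y : ℝ)))‖ ≤
          (L : ℝ) ^ ((1 : ℝ) - 2 ^ (-(r : ℝ) - 1)) +
            (L : ℝ) * (h : ℝ) ^ (-(2 : ℝ) ^ (-(r : ℝ) - 1)) := by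
  obtain ⟨j, rfl⟩ : ∃ j, r = j + 1 := ⟨r - 1, by omega⟩
  rcases Nat.eq_zero_or_pos j with rfl | hj
  · refine ⟨1, 1, by norm_num, by norm_num, fun y h d L _ _ h1 h2 => ?_⟩
    simp at h2; omega
  obtain ⟨D, hD⟩ := int_of_poly (j + 1) P hPdeg.le (fun n => ⟨f n, hfP n⟩)
  have hlc : P.coeff (j + 1) = P.leadingCoeff := by rw [Polynomial.leadingCoeff, hPdeg]
  have hDpos : 0 < D := by
    have : (0:ℚ) < D := by rw [hD, hlc]; positivity
    exact_mod_cast this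
  obtain ⟨D', rfl⟩ : ∃ D' : ℕ, D = D' := ⟨D.toNat, by omega⟩
  have hPP : ∀ y : ℝ, PP j (fun n => (f n : ℝ) * y) (D' * y) := by
    intro y
    have := pp_of_poly j P hPdeg.le y
    rw [← hD] at this
    convert this using 1
    · funext n
      rw [← hfP]; push_cast; rfl
    · push_cast; rfl
  obtain ⟨C, hC, hweyl⟩ := weyl j D' hj (by omega) f hPP
  obtain ⟨K, hK, hper⟩ := period_of_poly P f hfP
  obtain ⟨V, hV0, hV⟩ := variation_of_poly P j hPdeg.le f hfP
  set N : ℕ := 2 ^ j with hN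
  have hN2 : 2 ≤ N := by rw [hN]; exact le_self_pow₀ (by norm_num) (by omega)
  set κ : ℝ := 2 ^ (-((j + 1 : ℕ) : ℝ) - 1) with hκdef
  have hκ : κ * N = 1 / 4 := by
    rw [hκdef, hN]; push_cast
    rw [← Real.rpow_natCast, ← Real.rpow_add (by norm_num)]
    rw [show -((j:ℝ) + 1) - 1 + j = ((-2 : ℤ) : ℝ) by push_cast; ring, Real.rpow_intCast]
    norm_num
  set X : ℝ := 6 * C * K * 2 ^ N with hX
  have hX0 : 0 < X := by
    have : (0:ℝ) < K := by exact_mod_cast hK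
    positivity
  set Y : ℝ := 4 * C + 4 * (2 * Real.pi * V * K + K) with hY
  have hpi := Real.pi_pos
  have hVK : 0 ≤ 2 * Real.pi * V * K + K := by positivity
  have hY0 : 4 ≤ Y := by rw [hY]; linarith
  refine ⟨2 * (⌈X ^ (16 / 3 : ℝ)⌉₊ + 1), Y ^ (16 : ℕ), by omega, by positivity, ?_⟩
  intro y h d L hL hgcd hCf hh hy
  have hYL : Y ≤ (L:ℝ) ^ (1 / 16 : ℝ) := by
    calc Y = (Y ^ (16:ℕ)) ^ (1 / 16 : ℝ) := by
          rw [← Real.rpow_natCast, ← Real.rpow_mul (by linarith)]; norm_num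
      _ ≤ _ := by gcongr
  have hL1r : (1:ℝ) ≤ L := le_trans (one_le_pow₀ (by linarith)) hL
  have hL1 : 1 ≤ L := by exact_mod_cast hL1r
  have hh1 : 1 ≤ h := by omega
  obtain ⟨q, a, hq, hqa, hhq, hqX, hya, hya2⟩ :=
    approx j L h hL1 (hY0.trans hYL) d y hgcd hh1 hh hy
  change ‖∑ n ∈ Finset.Icc 1 L, ee ((f (n : ℤ) : ℝ) * y)‖ ≤
    (L:ℝ) ^ (1 - κ) + L * (h:ℝ) ^ (-κ)
  rcases le_total (√(L:ℝ)) q with hc | hc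
  · exact minor_final N j L q h (by omega) κ hκ C _ hC hL1 hq hh1 (by linarith) hhq hqX hc
      (hweyl L q a y hL1 hq hqa hya)
  · have hqC : X ≤ (q:ℝ) ^ (3 / 16 : ℝ) := by
      have h1 : X ^ (16 / 3 : ℝ) ≤ q := by
        refine (Nat.le_ceil _).trans ?_
        exact_mod_cast (by omega : ⌈X ^ (16 / 3 : ℝ)⌉₊ ≤ q)
      calc X = (X ^ (16 / 3 : ℝ)) ^ (3 / 16 : ℝ) := by
            rw [← Real.rpow_mul hX0.le]; norm_num
        _ ≤ _ := by gcongr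
    refine major_final N j K L q h hN2 hj hK κ hκ C V _
      ‖∑ n ∈ Finset.Icc 1 (K * q), ee ((f (n : ℤ) : ℝ) * (a / q))‖ |y - a / q| hC hV0
      (abs_nonneg _) (norm_nonneg _) hL1 hq hh1 (by linarith) hhq hqC hc hya2
      (major f K j hK hper V hV0 hV L q hq a y)
      (hweyl (K * q) q a (a / q) (Nat.mul_pos hK hq) hq hqa (by simp))
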